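/- Let S ⊆ E be an upper set and let 𝒞 be a finite family of boxes, each contained in S, whose union contains S. Then the cardinality of 𝒞 is at least the number of boxes that are maximal in S. (Thus the abbreviated d.n.f. of a monotone quasi-Boolean function is a shortest d.n.f.) -/

import Mathlib

/-- `B ⊆ Fin n → Fin k` is a box (interval/sublattice of the `n`-dimensional `k`-lattice):
`B = {x | ∀ j, x j ∈ M j}` with every `M j` nonempty. -/
def IsBox {n k : ℕ} (B : Set (Fin n → Fin k)) : Prop :=
  ∃ M : Fin n → Set (Fin k), (∀ j, (M j).Nonempty) ∧ B = {x | ∀ j, x j ∈ M j}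

/-- `B` is a box maximal in `S`: `B ⊆ S` and no box strictly between `B` and `S`. -/
def MaximalBoxIn {n k : ℕ} (S B : Set (Fin n → Fin k)) : Prop :=
  IsBox B ∧ B ⊆ S ∧ ∀ B' : Set (Fin n → Fin k), IsBox B' → B ⊂ B' → ¬B' ⊆ S

theorem IsBox.exists_isLeast {n k : ℕ} {B : Set (Fin n → Fin k)} (hB : IsBox B) :
    ∃ a, IsLeast B a := by
  obtain ⟨M, hM, rfl⟩ := hB
  choose a ha using fun j => (M j).toFinite.exists_minimal (hM j)
  refine ⟨a, fun j => (ha j).prop, fun x hx j => ?_⟩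
  exact (le_total (a j) (x j)).elim id fun h => (ha j).le_of_le (hx j) h

theorem isBox_Ici {n k : ℕ} (a : Fin n → Fin k) : IsBox (Set.Ici a) :=
  ⟨fun j => Set.Ici (a j), fun _ => Set.nonempty_Ici, rfl⟩

theorem MaximalBoxIn.eq_of_subset {n k : ℕ} {S B B' : Set (Fin n → Fin k)}
    (hB : MaximalBoxIn S B) (hB' : IsBox B') (h : B ⊆ B') (hS : B' ⊆ S) : B = B' := by
  by_contra hne
  exact hB.2.2 B' hB' (h.ssubset_of_ne hne) hS

theorem IsLeast.coe_upperClosure_eq {α : Type*} [Preorder α] {s : Set α} {a : α}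
    (h : IsLeast s a) : (upperClosure s : Set α) = Set.Ici a := by
  ext x
  simp only [SetLike.mem_coe, mem_upperClosure, Set.mem_Ici]
  exact ⟨fun ⟨y, hy, hyx⟩ => (h.2 hy).trans hyx, fun hx => ⟨a, h.1, hx⟩⟩

/-- The `shortest` claim of Theorem 1(b): any finite family of boxes contained in an
upper set `S` whose union contains `S` has at least as many members as there are boxes
maximal in `S`. -/
theorem card_cover_ge_card_maximal_boxes {n k : ℕ} (hk : 1 ≤ k)
    (S : Set (Fin n → Fin k)) (hS : IsUpperSet S)
    (𝒞 : Finset (Set (Fin n → Fin k)))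
    (h𝒞 : ∀ B ∈ 𝒞, IsBox B ∧ B ⊆ S)
    (hcov : S ⊆ ⋃ B ∈ 𝒞, B) :
    {B | MaximalBoxIn S B}.ncard ≤ 𝒞.card := by
  have hsub : {B | MaximalBoxIn S B} ⊆
      (fun C => (upperClosure C : Set (Fin n → Fin k))) '' (𝒞 : Set (Set (Fin n → Fin k))) := by
    intro B hB
    obtain ⟨a, ha⟩ := hB.1.exists_isLeast
    have haS : a ∈ S := hB.2.1 ha.1
    obtain ⟨C, hC, haC⟩ := Set.mem_iUnion₂.1 (hcov haS)
    obtain ⟨c, hc⟩ := (h𝒞 C hC).1.exists_isLeast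
    have hcS : c ∈ S := (h𝒞 C hC).2 hc.1
    refine ⟨C, hC, ?_⟩
    have hBc : B ⊆ Set.Ici c := fun x hx => (hc.2 haC).trans (ha.2 hx)
    exact hc.coe_upperClosure_eq.trans
      (hB.eq_of_subset (isBox_Ici c) hBc fun x hx => hS hx hcS).symm
  calc {B | MaximalBoxIn S B}.ncard
      ≤ _ := Set.ncard_le_ncard hsub (𝒞.finite_toSet.image _)
    _ ≤ (𝒞 : Set (Set (Fin n → Fin k))).ncard := Set.ncard_image_le 𝒞.finite_toSet
    _ = 𝒞.card := Set.ncard_coe_finset 𝒞
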